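/- arXiv:2103.11665 — 2 statements merged into one kernel-verified Lean document; each statement's English description precedes it below -/
import Mathlib

section
/- Let q = r^2 with r ≡ 1 (mod 4). Suppose a, b are even divisors of q-1 with a ≡ 2 (mod 4), 2a | b(r+1), and 2b | a(r-1). For any odd s with 1 ≤ s ≤ a/gcd(a,b) and any 1 ≤ t ≤ b/gcd(a,b), there exists a q-ary MDS Euclidean self-dual code of length n + 2 where n = s(q-1)/a + t(q-1)/b. -/
open Finset

variable {F : Type*} [Field F]

/-- `δ_A(aᵢ)` for a listed set `a : Fin n → F`. -/
noncomputable def delta {n : ℕ} (a : Fin n → F) (i : Fin n) : F :=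
  ∏ j ∈ Finset.univ.erase i, (a i - a j)

/-- `δ_S(x)` for a finite set `S ⊆ F`. -/
noncomputable def deltaSet [DecidableEq F] (S : Finset F) (x : F) : F :=
  ∏ y ∈ S.erase x, (x - y)

/-- Euclidean dual of a linear code. -/
def dualCode {n : ℕ} (C : Submodule F (Fin n → F)) : Submodule F (Fin n → F) where
  carrier := {x | ∀ y ∈ C, ∑ i, x i * y i = 0}
  add_mem' := by
    intro x y hx hy z hz
    simp [add_mul, Finset.sum_add_distrib, hx z hz, hy z hz]
  zero_mem' := by intro y hy; simp
  smul_mem' := by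
    intro c x hx y hy
    simp [smul_eq_mul, mul_assoc, ← Finset.mul_sum, hx y hy]

/-- Hamming weight. -/
noncomputable def wt {n : ℕ} (c : Fin n → F) : ℕ := Nat.card {i // c i ≠ 0}

/-- `C` is an `[n, k, n-k+1]` MDS code. -/
noncomputable def IsMDSCode {n : ℕ} (C : Submodule F (Fin n → F)) (k : ℕ) : Prop :=
  Module.finrank F C = k ∧ ∀ c ∈ C, c ≠ 0 → n - k + 1 ≤ wt c

noncomputable def GRSmap {n : ℕ} (a v : Fin n → F) : Polynomial F →ₗ[F] (Fin n → F) where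
  toFun f := fun i => v i * Polynomial.eval (a i) f
  map_add' f g := by funext i; simp [mul_add]
  map_smul' c f := by funext i; simp [Polynomial.eval_smul]; ring

/-- Generalized Reed–Solomon code `GRS_k(A, v)`. -/
noncomputable def GRS {n : ℕ} (k : ℕ) (a v : Fin n → F) : Submodule F (Fin n → F) :=
  Submodule.map (GRSmap a v) (Polynomial.degreeLT F k)

noncomputable def GRSextMap {n : ℕ} (k : ℕ) (a v : Fin n → F) :
    Polynomial F →ₗ[F] (Fin (n+1) → F) where
  toFun f := fun i =>
    if h : (i : ℕ) < n then v ⟨i, h⟩ * Polynomial.eval (a ⟨i, h⟩) f else f.coeff (k - 1)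
  map_add' f g := by
    funext i
    by_cases h : (i : ℕ) < n <;> simp [h, mul_add]
  map_smul' c f := by
    funext i
    by_cases h : (i : ℕ) < n <;> simp [h, Polynomial.eval_smul] <;> ring

/-- Extended generalized Reed–Solomon code `GRS_k(A ∪ {∞}, v)`. -/
noncomputable def GRSext {n : ℕ} (k : ℕ) (a v : Fin n → F) : Submodule F (Fin (n+1) → F) :=
  Submodule.map (GRSextMap k a v) (Polynomial.degreeLT F k)

open Polynomial in
theorem le_wt_GRSextMap {N k : ℕ} (hk : k ≤ N) {w v : Fin N → F} (hw : Function.Injective w)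
    (hv : ∀ i, v i ≠ 0) {f : F[X]} (hf : f ∈ degreeLT F k) (hf0 : f ≠ 0) :
    N + 1 - k + 1 ≤ wt (GRSextMap k w v f) := by
  classical
  have hdeg : f.natDegree < k := (natDegree_lt_iff_degree_lt hf0).2 (mem_degreeLT.1 hf)
  have hroots : #{i | f.eval (w i) = 0} ≤ f.natDegree := by
    rw [← card_image_of_injective _ hw]
    refine card_le_degree_of_subset_roots fun x hx => ?_
    obtain ⟨i, hi, rfl⟩ := mem_image.1 (mem_def.2 hx)
    exact (mem_roots hf0).2 (mem_filter.1 hi).2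
  have hsplit : #{i | f.eval (w i) = 0} + #{i | f.eval (w i) ≠ 0} = N := by
    simpa using card_filter_add_card_filter_not (s := univ) fun i => f.eval (w i) = 0
  have hwt : wt (GRSextMap k w v f) =
      #{i | f.eval (w i) ≠ 0} + if f.coeff (k - 1) ≠ 0 then 1 else 0 := by
    rw [wt, Nat.card_eq_fintype_card, Fintype.card_subtype, card_filter, Fin.sum_univ_castSucc,
      card_filter]
    simp [GRSextMap, hv]
  rw [hwt]
  split_ifs with hc
  · omega
  · have : f.natDegree ≠ k - 1 := fun h => hc <| by
      rw [← h]; exact leadingCoeff_ne_zero.2 hf0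
    omega

theorem finrank_add_finrank_dualCode {n : ℕ} (C : Submodule F (Fin n → F)) :
    Module.finrank F C + Module.finrank F (dualCode C) = n := by
  have h : dualCode C = C.dualAnnihilator.comap (dotProductEquiv F (Fin n)).toLinearMap := by
    ext x
    simp [dualCode, Submodule.mem_dualAnnihilator, dotProduct]
  have := Subspace.finrank_add_finrank_dualAnnihilator_eq C
  rw [h, LinearEquiv.finrank_eq ((dotProductEquiv F (Fin n)).ofSubmodule' C.dualAnnihilator), this,
    Module.finrank_fin_fun]

open Polynomial Lagrange in
theorem exists_isMDSCode_eq_dualCode {N k : ℕ} (hN : N + 1 = 2 * k)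
    (h1 : IsSquare (-1 : F)) (w : Fin N → F)
    (hne : ∀ i, (derivative (nodal univ w)).eval (w i) ≠ 0)
    (hsq : ∀ i, IsSquare ((derivative (nodal univ w)).eval (w i))) :
    ∃ C : Submodule F (Fin (N + 1) → F), IsMDSCode C k ∧ C = dualCode C := by
  classical
  have hδ (i) : (derivative (nodal univ w)).eval (w i) = ∏ j ∈ univ.erase i, (w i - w j) := by
    rw [eval_nodal_derivative_eval_node_eq (mem_univ i), eval_nodal]
  simp only [hδ] at hne hsq
  have hw : Function.Injective w := fun i j hij => by
    by_contra h
    exact hne i (prod_eq_zero (mem_erase.2 ⟨Ne.symm h, mem_univ j⟩) (by rw [hij, sub_self]))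
  choose c hc using hsq
  obtain ⟨z, hz⟩ := h1
  have hz0 : z ≠ 0 := by rintro rfl; simp at hz
  have hc0 (i) : c i ≠ 0 := fun h => hne i (by rw [hc, h, zero_mul])
  set v : Fin N → F := fun i => z / c i
  have hv (i) : v i ≠ 0 := div_ne_zero hz0 (hc0 i)
  have hkN : k ≤ N := by omega
  have hinj : Function.Injective ((GRSextMap k w v).domRestrict (degreeLT F k)) := by
    rw [← LinearMap.ker_eq_bot, LinearMap.ker_eq_bot']
    rintro ⟨f, hf⟩ h
    by_contra h0
    have := le_wt_GRSextMap hkN hw hv hf (fun h => h0 (Subtype.ext h))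
    simp only [LinearMap.domRestrict_apply] at h
    simp [h, wt] at this
  have hrank : Module.finrank F (GRSext k w v) = k := by
    rw [GRSext, ← LinearMap.range_domRestrict, LinearMap.finrank_range_of_inj hinj,
      (degreeLTEquiv F k).finrank_eq, Module.finrank_fin_fun]
  refine ⟨GRSext k w v, ⟨hrank, ?_⟩, ?_⟩
  · rintro _ ⟨f, hf, rfl⟩ h0
    exact le_wt_GRSextMap hkN hw hv hf fun h => h0 (by rw [h, map_zero])
  · refine Submodule.eq_of_le_of_finrank_eq ?_ ?_
    · rintro _ ⟨f, hf, rfl⟩ _ ⟨g, hg, rfl⟩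
      have hle {p : F[X]} (hp : p ∈ degreeLT F k) : p.natDegree ≤ k - 1 := by
        rw [show k = k - 1 + 1 by omega, degreeLT_succ_eq_degreeLE] at hp
        exact natDegree_le_of_degree_le (mem_degreeLE.1 hp)
      have hf' := hle hf
      have hg' := hle hg
      have hdeg : (f * g).degree < #(univ : Finset (Fin N)) := by
        refine (degree_le_of_natDegree_le (natDegree_mul_le_of_le hf' hg')).trans_lt ?_
        rw [card_univ, Fintype.card_fin]
        exact_mod_cast (by omega)
      have key := coeff_eq_sum (s := univ) hw.injOn hdeg
      rw [card_univ, Fintype.card_fin, show N - 1 = (k - 1) + (k - 1) by omega,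
        coeff_mul_add_eq_of_natDegree_le hf' hg'] at key
      rw [Fin.sum_univ_castSucc]
      simp only [GRSextMap, LinearMap.coe_mk, AddHom.coe_mk, Fin.val_castSucc, Fin.is_lt,
        dite_true, Fin.val_last, lt_irrefl, dite_false, Fin.eta, key]
      rw [← sum_add_distrib]
      refine sum_eq_zero fun i _ => ?_
      rw [hc, eval_mul]
      have := hc0 i
      simp only [v]
      field_simp
      linear_combination (-eval (w i) f * eval (w i) g) * hz
    · have := finrank_add_finrank_dualCode (GRSext k w v)
      omega

theorem exists_ringHom_eq_pow [Fintype F] {r n : ℕ} (hr : IsPrimePow r)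
    (hF : Fintype.card F = r ^ n) : ∃ σ : F →+* F, ∀ x, σ x = x ^ r := by
  obtain ⟨p, k, hp, -, rfl⟩ := hr
  have hp := hp.nat_prime
  have := Fact.mk hp
  have : CharP F p := (CharP.charP_iff_prime_eq_zero hp).2 <| by
    have h := Nat.cast_card_eq_zero F
    rw [hF, ← pow_mul, Nat.cast_pow] at h
    exact eq_zero_of_pow_eq_zero h
  exact ⟨iterateFrobenius F p k, fun x => iterateFrobenius_def p k x⟩

theorem pow_mul_eq_one_of_pow_succ_eq_self {x : F} {R : ℕ} (h : ℕ) (hx0 : x ≠ 0)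
    (hx : x ^ (R + 1) = x) : x ^ (R * h) = 1 := by
  rw [pow_mul, mul_right_cancel₀ hx0 (by rw [← pow_succ, hx, one_mul] : x ^ R * x = 1 * x), one_pow]

theorem sub_pow_mul_mul_pow {σ : F →+* F} {R h : ℕ} (hR : R + 2 = 2 * h)
    (hσ : ∀ x, σ x = x ^ (R + 1)) {x y : F} (hx : x ^ (2 * h) = 1) (hy : y ^ (2 * h) = 1)
    (hxy : x ≠ y) : (x - y) ^ (R * h) * (x * y) ^ h = (-1) ^ h := by
  rw [pow_mul, ← mul_pow]
  congr 1
  refine mul_right_cancel₀ (sub_ne_zero.2 hxy) ?_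
  have h1 := hσ (x - y)
  rw [map_sub, hσ, hσ] at h1
  rw [← hR] at hx hy
  linear_combination -x * y * h1 + y * hx - x * hy

open Polynomial in
theorem eval_derivative_mul_of_eval_eq_zero {p q : F[X]} {x : F} (hp : p.eval x = 0) :
    (derivative (p * q)).eval x = (derivative p).eval x * q.eval x := by
  simp [hp]

open Polynomial in
theorem eval_derivative_X_mul_prod_mul {s e : ℕ} (he : e ≠ 0) (c : Fin s → F) (q : F[X]) {x : F}
    (i : Fin s) (hx : x ^ e = c i) :
    (derivative (X * ((∏ i, (X ^ e - C (c i))) * q))).eval x =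
      e * c i * ((∏ l ∈ univ.erase i, (c i - c l)) * q.eval x) := by
  rw [← mul_prod_erase univ _ (mem_univ i),
    show ∀ u v w : F[X], X * (u * v * w) = u * (X * (v * w)) by intros; ring,
    eval_derivative_mul_of_eval_eq_zero (by simp [hx])]
  simp only [derivative_sub, derivative_X_pow, derivative_C, eval_mul, eval_sub, eval_pow, eval_X,
    eval_C, eval_prod, sub_zero, hx]
  rw [← hx, ← pow_sub_one_mul he x]
  ring

/-- The point `0` together with the cosets `θ ^ (b * i) • ⟨θ ^ a⟩` and
`θ ^ (a * j + c) • ⟨θ ^ b⟩` for `i < s` and `j < t`. -/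
def cosetPoints (θ : F) (a b c : ℕ) (s t e f : ℕ) :
    Option ((Fin s × Fin e) ⊕ (Fin t × Fin f)) → F
  | none => 0
  | some (.inl x) => (θ ^ a) ^ (x.2 : ℕ) * θ ^ (b * x.1)
  | some (.inr x) => (θ ^ b) ^ (x.2 : ℕ) * θ ^ (a * x.1 + c)

open Polynomial Lagrange in
theorem nodal_cosetPoints {θ : F} {a b e f : ℕ} (c s t : ℕ) (he : e ≠ 0) (hf : f ≠ 0)
    (ha : IsPrimitiveRoot (θ ^ a) e) (hb : IsPrimitiveRoot (θ ^ b) f) :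
    nodal univ (cosetPoints θ a b c s t e f) =
      X * ((∏ i : Fin s, (X ^ e - C (θ ^ (b * i * e)))) *
        ∏ j : Fin t, (X ^ f - C (θ ^ ((a * j + c) * f)))) := by
  rw [nodal_eq, Fintype.prod_option, Fintype.prod_sum_type, Fintype.prod_prod_type,
    Fintype.prod_prod_type]
  simp only [cosetPoints, C_0, sub_zero]
  congr 2
  · refine prod_congr rfl fun i _ => ?_
    rw [X_pow_sub_C_eq_prod ha (Nat.pos_of_ne_zero he) (pow_mul θ _ _).symm,
      ← Fin.prod_univ_eq_prod_range fun k => X - C ((θ ^ a) ^ k * θ ^ (b * (i : ℕ)))]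
  · refine prod_congr rfl fun i _ => ?_
    rw [X_pow_sub_C_eq_prod hb (Nat.pos_of_ne_zero hf) (pow_mul θ _ _).symm,
      ← Fin.prod_univ_eq_prod_range fun k => X - C ((θ ^ b) ^ k * θ ^ (a * (i : ℕ) + c))]

open Polynomial Lagrange in
theorem eval_derivative_nodal_cosetPoints_pow_eq_one {θ : F} {σ : F →+* F}
    {R h α β e f k l s t : ℕ} (hσ : ∀ x, σ x = x ^ (R + 1)) (hR : R + 2 = 2 * h) (hR0 : R ≠ 0)
    (hR2 : Even R) (hh : Odd h) (hα : Odd α) (hθ : IsPrimitiveRoot θ (2 * (R * h)))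
    (hF : ((2 * (R * h) : ℕ) : F) ≠ 0)
    (he : α * e = R * h) (hf : β * f = R * h) (hk : β * e = R * k) (hl : α * f = 2 * h * l)
    (hs : Odd s) (hsξ : s ≤ orderOf (θ ^ (2 * β * e))) (htφ : t ≤ orderOf (θ ^ (2 * α * f)))
    (x : Option ((Fin s × Fin e) ⊕ (Fin t × Fin f))) :
    (derivative (nodal univ (cosetPoints θ (2 * α) (2 * β) α s t e f))).eval
      (cosetPoints θ (2 * α) (2 * β) α s t e f x) ^ (R * h) = 1 := by
  have hm0 : R * h ≠ 0 := mul_ne_zero hR0 (by omega)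
  have he0 : e ≠ 0 := right_ne_zero_of_mul (he ▸ hm0)
  have hf0 : f ≠ 0 := right_ne_zero_of_mul (hf ▸ hm0)
  have hm2 : Even (R * h) := hR2.mul_right h
  have hθ1 : θ ^ (2 * (R * h)) = 1 := hθ.pow_eq_one
  have hθm : θ ^ (R * h) = -1 :=
    (hθ.pow (by omega) (mul_comm 2 (R * h))).eq_neg_one_of_two_right
  have h11 : (1 : F) ≠ -1 := fun h1 => by
    have h2 : (2 : F) = 0 := by linear_combination h1
    exact hF (by push_cast; rw [h2, zero_mul])
  set ξ := θ ^ (2 * β * e) with hξ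
  set φ := θ ^ (α * f) with hφ
  have hξh : ξ ^ h = 1 := by
    rw [hξ, ← pow_mul, show 2 * β * e * h = 2 * (R * h) * k by rw [mul_assoc 2, hk]; ring, pow_mul,
      hθ1, one_pow]
  have hφR : φ ^ R = 1 := by
    rw [hφ, ← pow_mul, show α * f * R = 2 * (R * h) * l by rw [hl]; ring, pow_mul, hθ1, one_pow]
  have hφβ : φ ^ β = -1 := by
    rw [hφ, ← pow_mul, show α * f * β = R * h * α by rw [← hf]; ring, pow_mul, hθm, hα.neg_one_pow]
  have hξh' (i : ℕ) : (ξ ^ i) ^ h = 1 := by rw [pow_right_comm, hξh, one_pow]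
  have hξm (i : ℕ) : (ξ ^ i) ^ (R * h) = 1 := by rw [mul_comm, pow_mul, hξh', one_pow]
  have hφR' (i : ℕ) : (φ ^ i) ^ (R + 1) = φ ^ i := by
    rw [pow_succ, pow_right_comm, hφR, one_pow, one_mul]
  have hφ0 (i : ℕ) : φ ^ i ≠ 0 := pow_ne_zero _ fun h0 => by
    rw [h0, zero_pow hR0] at hφR; exact zero_ne_one hφR
  have hφm (i : ℕ) : (φ ^ i) ^ (R * h) = 1 := pow_mul_eq_one_of_pow_succ_eq_self h (hφ0 i) (hφR' i)
  have hφsub {i j : ℕ} (hij : φ ^ i ≠ φ ^ j) : (φ ^ i - φ ^ j) ^ (R * h) = 1 :=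
    pow_mul_eq_one_of_pow_succ_eq_self h (sub_ne_zero.2 hij)
      (by rw [← hσ, map_sub, hσ, hσ, hφR', hφR'])
  have hξsub {i j : ℕ} (hij : ξ ^ i ≠ ξ ^ j) : (ξ ^ i - ξ ^ j) ^ (R * h) = -1 := by
    have := sub_pow_mul_mul_pow hR hσ (x := ξ ^ i) (y := ξ ^ j)
      (by rw [mul_comm, pow_mul, hξh', one_pow]) (by rw [mul_comm, pow_mul, hξh', one_pow]) hij
    rwa [mul_pow, hξh', hξh', mul_one, mul_one, hh.neg_one_pow] at this
  have hξadd (i j : ℕ) : (-ξ ^ i - ξ ^ j) ^ (R * h) = 1 := by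
    have hi : (-ξ ^ i) ^ h = -1 := by rw [hh.neg_pow, hξh']
    have := sub_pow_mul_mul_pow hR hσ (x := -ξ ^ i) (y := ξ ^ j)
      (by rw [mul_comm, pow_mul, hi, neg_one_sq]) (by rw [mul_comm, pow_mul, hξh', one_pow])
      (fun hij => h11 (by rw [← hi, hij, hξh']))
    rw [mul_pow, hi, hξh', hh.neg_one_pow] at this
    linear_combination -this
  have hcast {n : ℕ} (hn : n ∣ R * h) : (n : F) ^ (R * h) = 1 := by
    refine pow_mul_eq_one_of_pow_succ_eq_self h (fun h0 => hF ?_) (by rw [← hσ, map_natCast])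
    obtain ⟨d, hd⟩ := hn
    rw [hd]; push_cast; rw [h0]; ring
  have hP : nodal univ (cosetPoints θ (2 * α) (2 * β) α s t e f) =
      X * ((∏ i : Fin s, (X ^ e - C (ξ ^ (i : ℕ)))) *
        ∏ j : Fin t, (X ^ f - C (φ ^ (2 * (j : ℕ) + 1)))) := by
    rw [nodal_cosetPoints α s t he0 hf0 (hθ.pow (by omega) (by rw [← he]; ring))
      (hθ.pow (by omega) (by rw [← hf]; ring))]
    congr 3
    · ext1 i
      rw [hξ, ← pow_mul]; ring_nf
    · ext1 j
      rw [hφ, ← pow_mul]; ring_nf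
  rw [hP]
  rcases x with _ | ⟨i, n⟩ | ⟨j, n⟩
  · rw [eval_derivative_mul_of_eval_eq_zero (by simp [cosetPoints])]
    simp [cosetPoints, eval_prod, he0, hf0, mul_pow, ← prod_pow, hm2.neg_pow, hξm, hφm]
  · have hxe : cosetPoints θ (2 * α) (2 * β) α s t e f (some (.inl (i, n))) ^ e = ξ ^ (i : ℕ) := by
      simp only [cosetPoints, mul_pow, ← pow_mul]
      rw [
        show 2 * α * (n : ℕ) * e = 2 * (R * h) * n by rw [← he]; ring, pow_mul, hθ1, one_pow, one_mul,
        hξ, ← pow_mul]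
      ring_nf
    have hxf : cosetPoints θ (2 * α) (2 * β) α s t e f (some (.inl (i, n))) ^ f =
        φ ^ (2 * (n : ℕ)) := by
      simp only [cosetPoints, mul_pow, ← pow_mul]
      rw [
        show 2 * β * (i : ℕ) * f = 2 * (R * h) * i by rw [← hf]; ring, pow_mul θ (2 * (R * h)), hθ1,
        one_pow, mul_one, hφ, ← pow_mul]
      ring_nf
    rw [eval_derivative_X_mul_prod_mul he0 (fun i : Fin s => ξ ^ (i : ℕ)) _ i hxe]
    simp only [eval_prod, eval_sub, eval_pow, eval_X, eval_C, hxf, mul_pow, ← prod_pow, hξm]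
    rw [hcast ⟨α, by rw [← he, mul_comm]⟩, prod_congr rfl (g := fun _ => -1), prod_const,
      card_erase_of_mem (mem_univ i), card_univ, Fintype.card_fin,
      (Nat.Odd.sub_odd hs odd_one).neg_one_pow, prod_eq_one]
    · simp
    · refine fun j _ => hφsub fun hij => h11 ?_
      have := congrArg (· ^ β) hij
      rwa [pow_right_comm, pow_right_comm φ _ β, hφβ, (even_two_mul _).neg_one_pow,
        (odd_two_mul_add_one _).neg_one_pow] at this
    · refine fun l hl => hξsub fun hil => ne_of_mem_erase hl (Fin.ext ?_)
      exact (pow_injOn_Iio_orderOf (i.2.trans_le hsξ) (l.2.trans_le hsξ) hil).symm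
  · have hxe : cosetPoints θ (2 * α) (2 * β) α s t e f (some (.inr (j, n))) ^ e =
        -ξ ^ (n : ℕ) := by
      simp only [cosetPoints, mul_pow, ← pow_mul]
      rw [
        show (2 * α * (j : ℕ) + α) * e = 2 * (R * h) * j + R * h by
          rw [← he]; ring, pow_add, pow_mul θ (2 * (R * h)),
        hθ1, one_pow, hθm, hξ, ← pow_mul]
      ring_nf
    have hxf : cosetPoints θ (2 * α) (2 * β) α s t e f (some (.inr (j, n))) ^ f =
        φ ^ (2 * (j : ℕ) + 1) := by
      simp only [cosetPoints, mul_pow, ← pow_mul]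
      rw [
        show 2 * β * (n : ℕ) * f = 2 * (R * h) * n by rw [← hf]; ring, pow_mul θ (2 * (R * h)), hθ1,
        one_pow, one_mul, hφ, ← pow_mul]
      ring_nf
    rw [mul_comm (∏ i : Fin s, _),
      eval_derivative_X_mul_prod_mul hf0 (fun j : Fin t => φ ^ (2 * (j : ℕ) + 1)) _ j hxf]
    simp only [eval_prod, eval_sub, eval_pow, eval_X, eval_C, hxe, mul_pow, ← prod_pow, hφm, hξadd]
    rw [hcast ⟨β, by rw [← hf, mul_comm]⟩, prod_eq_one]
    · simp
    · refine fun l hl => hφsub fun hjl => ne_of_mem_erase hl (Fin.ext ?_)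
      rw [pow_succ, pow_succ, pow_mul, pow_mul] at hjl
      have hφ2 : φ ^ 2 = θ ^ (2 * α * f) := by rw [hφ, ← pow_mul]; ring_nf
      rw [hφ2] at hjl
      exact (pow_injOn_Iio_orderOf (j.2.trans_le htφ) (l.2.trans_le htφ)
        (mul_right_cancel₀ (by simpa using hφ0 1) hjl)).symm

theorem exists_isPrimitiveRoot_of_card_eq [Fintype F] {n : ℕ} (hF : Fintype.card F = n + 1) :
    ∃ θ : F, IsPrimitiveRoot θ n := by
  classical
  obtain ⟨g, hg⟩ := IsCyclic.exists_generator (α := Fˣ)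
  refine ⟨g, IsPrimitiveRoot.coe_units_iff.2 (IsPrimitiveRoot.iff_orderOf.2 ?_)⟩
  rw [orderOf_eq_card_of_forall_mem_zpowers hg, Nat.card_eq_fintype_card, Fintype.card_units, hF,
    Nat.add_sub_cancel]

theorem orderOf_pow_mul_of_isPrimitiveRoot {θ : F} {a b f : ℕ} (hθ : IsPrimitiveRoot θ (b * f))
    (ha : a ≠ 0) (hf : f ≠ 0) : orderOf (θ ^ (a * f)) = b / b.gcd a := by
  rw [orderOf_pow' _ (mul_ne_zero ha hf), ← hθ.eq_orderOf, Nat.gcd_mul_right,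
    Nat.mul_div_mul_right _ _ (Nat.pos_of_ne_zero hf)]

/-- Theorem 1(ii): `q = r²`, `r ≡ 1 (mod 4)`, `a, b` even divisors of `q-1`, `a ≡ 2 (mod 4)`,
`2a ∣ b(r+1)`, `2b ∣ a(r-1)`, `s` odd with `1 ≤ s ≤ a/gcd(a,b)`, `1 ≤ t ≤ b/gcd(a,b)`:
there exists a `q`-ary MDS Euclidean self-dual code of length `n + 2`, where
`n = s(q-1)/a + t(q-1)/b`. -/
theorem stmt13 {F : Type*} [Field F] [Fintype F] {q r : ℕ} (hq : Fintype.card F = q)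
    (hq2 : q = r ^ 2) (hpp : IsPrimePow r) (hr4 : r % 4 = 1)
    {a b : ℕ} (hae : Even a) (hbe : Even b) (ha : a ∣ q - 1) (hb : b ∣ q - 1)
    (ha4 : a % 4 = 2) (hab : 2 * a ∣ b * (r + 1)) (hba : 2 * b ∣ a * (r - 1))
    {s t : ℕ} (hs : Odd s) (hs1 : 1 ≤ s) (hs2 : s ≤ a / Nat.gcd a b)
    (ht1 : 1 ≤ t) (ht2 : t ≤ b / Nat.gcd a b) :
    ∃ C : Submodule F (Fin (s * ((q - 1) / a) + t * ((q - 1) / b) + 2) → F),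
      IsMDSCode C ((s * ((q - 1) / a) + t * ((q - 1) / b) + 2) / 2) ∧ C = dualCode C := by
  classical
  obtain ⟨σ, hσ⟩ := exists_ringHom_eq_pow hpp (hq.trans hq2)
  obtain ⟨R, rfl⟩ : ∃ R, r = R + 1 := ⟨r - 1, by omega⟩
  obtain ⟨h, hR⟩ : ∃ h, R + 2 = 2 * h := ⟨R / 2 + 1, by omega⟩
  have hR0 : R ≠ 0 := by rintro rfl; exact not_isPrimePow_one hpp
  have hR2 : Even R := Nat.even_iff.2 (by omega)
  have hh : Odd h := Nat.odd_iff.2 (by omega)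
  have hm0 : R * h ≠ 0 := mul_ne_zero hR0 (by omega)
  have hcard : q = 2 * (R * h) + 1 := by
    rw [hq2, show 2 * (R * h) = R * (2 * h) by ring, ← hR]; ring
  obtain ⟨α, rfl⟩ := hae.two_dvd
  obtain ⟨β, rfl⟩ := hbe.two_dvd
  have hα : Odd α := Nat.odd_iff.2 (by omega)
  rw [hcard, Nat.add_sub_cancel] at ha hb ⊢
  have hα0 : 0 < α := hα.pos
  have hβ0 : 0 < β := Nat.pos_of_ne_zero fun h0 => by
    rw [h0, mul_zero, zero_dvd_iff] at hb; omega
  have hae' := Nat.mul_div_cancel' ha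
  have hbf' := Nat.mul_div_cancel' hb
  set e := 2 * (R * h) / (2 * α)
  set f := 2 * (R * h) / (2 * β)
  have he : α * e = R * h := by linarith
  have hf : β * f = R * h := by linarith
  have he0 : e ≠ 0 := right_ne_zero_of_mul (he ▸ hm0)
  have hf0 : f ≠ 0 := right_ne_zero_of_mul (hf ▸ hm0)
  obtain ⟨k, hk⟩ : ∃ k, β * e = R * k := by
    obtain ⟨k, hk⟩ := hab
    refine ⟨k, Nat.eq_of_mul_eq_mul_left hα0 ?_⟩
    rw [add_assoc, hR] at hk
    have hk : β * h = α * k := by linarith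
    linear_combination β * he + R * hk
  obtain ⟨l, hl⟩ : ∃ l, α * f = 2 * h * l := by
    obtain ⟨l, hl⟩ := hba
    refine ⟨l, Nat.eq_of_mul_eq_mul_left hβ0 ?_⟩
    rw [Nat.add_sub_cancel] at hl
    have hl : α * R = 2 * (β * l) := by linarith
    linear_combination α * hf + h * hl
  obtain ⟨θ, hθ⟩ := exists_isPrimitiveRoot_of_card_eq (hq.trans hcard)
  have hF : ((2 * (R * h) : ℕ) : F) ≠ 0 := fun h0 => by
    have := Nat.cast_card_eq_zero F
    rw [hq, hcard, Nat.cast_add, h0] at this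
    simp at this
  have hsξ : s ≤ orderOf (θ ^ (2 * β * e)) := by
    rwa [orderOf_pow_mul_of_isPrimitiveRoot (hae' ▸ hθ) (by omega) he0]
  have htφ : t ≤ orderOf (θ ^ (2 * α * f)) := by
    rwa [orderOf_pow_mul_of_isPrimitiveRoot (hbf' ▸ hθ) (by omega) hf0, Nat.gcd_comm]
  have hpow := eval_derivative_nodal_cosetPoints_pow_eq_one hσ hR hR0 hR2 hh hα hθ hF he hf hk hl
    hs hsξ htφ
  have hne {x : F} (hx : x ^ (R * h) = 1) : x ≠ 0 := fun h0 => by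
    rw [h0, zero_pow hm0] at hx
    exact zero_ne_one hx
  have hsq {x : F} (hx : x ^ (R * h) = 1) : IsSquare x := by
    have h2 : ringChar F ≠ 2 := fun h2 => hF <| by
      rw [Nat.cast_mul, ← h2, ringChar.Nat.cast_ringChar, zero_mul]
    rw [FiniteField.isSquare_iff h2 (hne hx), hq, hcard,
      show (2 * (R * h) + 1) / 2 = R * h by omega, hx]
  have he2 : Even e := (Nat.even_mul.1 (he ▸ hR2.mul_right h)).resolve_left (by simpa using hα)
  have hf2 : Even f :=
    (Nat.even_mul.1 (hl ▸ (even_two_mul h).mul_right l)).resolve_left (by simpa using hα)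
  have hn : Even (s * e + t * f) := (he2.mul_left s).add (hf2.mul_left t)
  let ε : Fin (s * e + t * f + 1) ≃ Option ((Fin s × Fin e) ⊕ (Fin t × Fin f)) :=
    (Fintype.equivFinOfCardEq (by simp)).symm
  have hnodal (u : Option ((Fin s × Fin e) ⊕ (Fin t × Fin f)) → F) :
      Lagrange.nodal univ (u ∘ ε) = Lagrange.nodal univ u := by
    rw [Lagrange.nodal_eq, Lagrange.nodal_eq]
    exact ε.prod_comp fun x => Polynomial.X - Polynomial.C (u x)
  refine exists_isMDSCode_eq_dualCode (by obtain ⟨d, hd⟩ := hn; omega)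
    (hsq (hR2.mul_right h).neg_one_pow)
    (cosetPoints θ (2 * α) (2 * β) α s t e f ∘ ε) (fun i => ?_) fun i => ?_
  · rw [hnodal]
    exact hne (hpow (ε i))
  · rw [hnodal]
    exact hsq (hpow (ε i))
end

section
/- Let q = r^2. Suppose a, b are even divisors of q-1 with 2a | b(r+1), 2b | a(r-1), and either (r ≡ 1 mod 4 and a ≡ 2 mod 4) or (r ≡ 3 mod 4 and b ≡ 2 mod 4). Let n = s(q-1)/a + t(q-1)/b with 1 ≤ s ≤ a/gcd(a,b), 1 ≤ t ≤ b/gcd(a,b). Then for every 1 ≤ k ≤ n/2 - 1 there exists a q-ary [n, k] MDS Euclidean self-orthogonal code. -/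
open Finset

variable {F : Type*} [Field F]

open Polynomial in
/-- A generalized Reed–Solomon code with distinct nodes and nonzero multipliers is MDS. -/
lemma isMDSCode_GRS {n k : ℕ} {a v : Fin n → F} (ha : Function.Injective a)
    (hv : ∀ i, v i ≠ 0) (hk : k ≤ n) : IsMDSCode (GRS k a v) k := by
  classical
  have hzero : ∀ f ∈ degreeLT F k, ∀ s : Finset (Fin n), k ≤ #s →
      (∀ i ∈ s, GRSmap a v f i = 0) → f = 0 := by
    intro f hf s hs h
    refine eq_zero_of_degree_lt_of_eval_index_eq_zero (s := s) (v := a) ha.injOn ?_ fun i hi => ?_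
    · exact (mem_degreeLT.1 hf).trans_le (by exact_mod_cast hs)
    · exact (mul_eq_zero.1 (h i hi)).resolve_left (hv i)
  constructor
  · rw [GRS, ← LinearMap.range_domRestrict, LinearMap.finrank_range_of_inj,
      (degreeLTEquiv F k).finrank_eq, Module.finrank_fin_fun]
    refine (injective_iff_map_eq_zero _).2 fun f hf => ?_
    exact Subtype.ext (hzero f f.2 univ (by simpa using hk) fun i _ => congrFun hf i)
  · rintro c ⟨f, hf, rfl⟩ hc
    by_contra! hlt
    refine hc ?_
    rw [hzero f hf {i | GRSmap a v f i = 0} ?_ (by simp), map_zero]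
    have hsum := card_filter_add_card_filter_not (s := (univ : Finset (Fin n)))
      (fun i => GRSmap a v f i = 0)
    rw [wt, Nat.card_eq_fintype_card, Fintype.card_subtype] at hlt
    simp only [card_univ, Fintype.card_fin] at hsum
    simp only [ne_eq] at hlt
    omega

open Polynomial in
/-- If `c xᵢ ^ ε δ(xᵢ)` is always a square, suitable multipliers make the generalized
Reed–Solomon code with nodes `xᵢ` self-orthogonal as soon as `2 k + ε ≤ n`. -/
lemma exists_isMDSCode_le_dualCode {ι : Type*} [Fintype ι] [DecidableEq ι] {x : ι → F}
    (hx : Function.Injective x) (hx0 : ∀ i, x i ≠ 0) {c : F} (hc : c ≠ 0) {ε k n : ℕ}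
    (hn : Fintype.card ι = n) (hk1 : 1 ≤ k) (hk : 2 * k + ε ≤ n)
    (hsq : ∀ i, IsSquare (c * x i ^ ε * ∏ j ∈ univ.erase i, (x i - x j))) :
    ∃ C : Submodule F (Fin n → F), IsMDSCode C k ∧ C ≤ dualCode C := by
  let e : Fin n ≃ ι := (Fintype.equivFinOfCardEq hn).symm
  choose y hy using hsq
  have hδ : ∀ i, ∏ j ∈ univ.erase i, (x i - x j) ≠ 0 := fun i =>
    prod_ne_zero_iff.2 fun j hj => sub_ne_zero.2 fun h => (mem_erase.1 hj).1 (hx h).symm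
  have hy0 : ∀ i, y i ≠ 0 := fun i h => by
    have := hy i
    rw [h, mul_zero] at this
    exact mul_ne_zero (mul_ne_zero hc (pow_ne_zero _ (hx0 i))) (hδ i) this
  refine ⟨GRS k (x ∘ e) fun i => y (e i) / ∏ j ∈ univ.erase (e i), (x (e i) - x j),
    isMDSCode_GRS (hx.comp e.injective) (fun i => div_ne_zero (hy0 _) (hδ _)) (by omega), ?_⟩
  rintro _ ⟨f, hf, rfl⟩ _ ⟨g, hg, rfl⟩
  have hnd : ∀ p ∈ degreeLT F k, p.natDegree ≤ k - 1 := fun p hp => by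
    rw [natDegree_le_iff_degree_le]
    have := mem_degreeLT.1 hp
    rw [degree_lt_iff_coeff_zero] at this
    rw [degree_le_iff_coeff_zero]
    exact fun m hm => this m (by have : k - 1 < m := by exact_mod_cast hm
                                 omega)
  have hdeg : (C c * X ^ ε * (f * g)).natDegree < n - 1 := by
    have h1 := natDegree_mul_le (p := C c * X ^ ε) (q := f * g)
    have h2 := natDegree_mul_le (p := f) (q := g)
    have h3 := natDegree_C_mul_X_pow_le c ε
    have h4 := hnd f hf
    have h5 := hnd g hg
    omega
  have hsum := Lagrange.coeff_eq_sum (s := univ) (v := x) hx.injOn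
    (P := C c * X ^ ε * (f * g)) (by
      rw [card_univ, hn]
      refine degree_le_natDegree.trans_lt ?_
      exact_mod_cast (by omega : (C c * X ^ ε * (f * g)).natDegree < n))
  rw [card_univ, hn, coeff_eq_zero_of_natDegree_lt hdeg] at hsum
  rw [hsum, ← e.sum_comp]
  refine sum_congr rfl fun i _ => ?_
  have := hy (e i)
  have hd := hδ (e i)
  simp only [GRSmap, LinearMap.coe_mk, AddHom.coe_mk, Function.comp_apply, eval_mul, eval_C,
    eval_pow, eval_X]
  field_simp
  rw [pow_two, ← this]
  ring

open Polynomial in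
lemma prod_X_sub_C_coset {m : ℕ} {ζ : F} (hζ : IsPrimitiveRoot ζ m) (hm : 0 < m) (y : F) :
    ∏ l : Fin m, (X - C (y * ζ ^ (l : ℕ))) = X ^ m - C (y ^ m) := by
  rw [X_pow_sub_C_eq_prod hζ hm rfl, ← Fin.prod_univ_eq_prod_range]
  simp_rw [mul_comm]

open Polynomial in
lemma eval_derivative_prod_mul {κ : Type*} [DecidableEq κ] {s : Finset κ} {A : κ → F[X]}
    {B : F[X]} {i : κ} (hi : i ∈ s) {x : F} (h : eval x (A i) = 0) :
    eval x (derivative ((∏ j ∈ s, A j) * B)) =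
      eval x (derivative (A i)) * ((∏ j ∈ s.erase i, eval x (A j)) * eval x B) := by
  rw [← mul_prod_erase s A hi]
  simp [derivative_mul, h, eval_prod, mul_assoc]

/-- Elements of norm one: the quadratic character of a difference. -/
lemma mul_pow_sub_of_norm_eq_one {r h : ℕ} (hr : r + 1 = 2 * h) (hh : 2 ≤ h)
    (hfrob : ∀ x y : F, (x - y) ^ r = x ^ r - y ^ r) {y w : F} (hyw : y - w ≠ 0)
    (hy : y ^ (r + 1) = 1) (hw : w ^ h = 1) :
    y ^ h * (y - w) ^ ((r - 1) * h) = (-1) ^ h := by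
  have hw' : w ^ (r + 1) = 1 := by rw [hr, mul_comm, pow_mul, hw, one_pow]
  have key : y * w * (y - w) ^ (r - 1) = -1 := by
    refine mul_right_cancel₀ hyw ?_
    calc y * w * (y - w) ^ (r - 1) * (y - w) = y * w * (y - w) ^ r := by
          rw [mul_assoc, ← pow_succ, Nat.sub_add_cancel (by omega)]
      _ = y ^ (r + 1) * w - w ^ (r + 1) * y := by rw [hfrob]; ring
      _ = -1 * (y - w) := by rw [hy, hw']; ring
  rw [← key, mul_pow, mul_pow, hw, mul_one, pow_mul]

/-- The elements listed by `Sum.inl` run through `s` cosets of `⟨α⟩`, those listed by `Sum.inr`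
through `t` cosets of `⟨β⟩`. -/
def cosetNodes (α β γ : F) (s m t m' : ℕ) : (Fin s × Fin m) ⊕ (Fin t × Fin m') → F :=
  Sum.elim (fun p => β ^ (p.1 : ℕ) * α ^ (p.2 : ℕ))
    (fun p => γ * α ^ (p.1 : ℕ) * β ^ (p.2 : ℕ))

section cosetNodes

variable {α β γ : F} {s m t m' : ℕ}

lemma cosetNodes_pow_inl {N : ℕ} (hα : α ^ N = 1) (hβ : β ^ N = 1) (p : Fin s × Fin m) :
    cosetNodes α β γ s m t m' (.inl p) ^ N = 1 := by
  simp [cosetNodes, mul_pow, pow_right_comm _ _ N, hα, hβ]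

lemma cosetNodes_pow_inr {N : ℕ} (hα : α ^ N = 1) (hβ : β ^ N = 1) (p : Fin t × Fin m') :
    cosetNodes α β γ s m t m' (.inr p) ^ N = γ ^ N := by
  simp [cosetNodes, mul_pow, pow_right_comm _ _ N, hα, hβ]

lemma cosetNodes_injective {N : ℕ} (hα : IsPrimitiveRoot α m) (hβ : IsPrimitiveRoot β m')
    (hα0 : α ≠ 0) (hβ0 : β ≠ 0) (hγ0 : γ ≠ 0)
    (hαN : α ^ N = 1) (hβN : β ^ N = 1) (hγN : γ ^ N ≠ 1)
    (hω : Function.Injective fun i : Fin s => (β ^ m) ^ (i : ℕ))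
    (hν : Function.Injective fun j : Fin t => (α ^ m') ^ (j : ℕ)) :
    Function.Injective (cosetNodes α β γ s m t m') := by
  rintro (⟨i, l⟩ | ⟨j, l⟩) (⟨i', l'⟩ | ⟨j', l'⟩) h
  · simp only [cosetNodes, Sum.elim_inl] at h
    have := congrArg (· ^ m) h
    simp only [mul_pow, pow_right_comm _ _ m, hα.pow_eq_one, one_pow, mul_one] at this
    obtain rfl := hω this
    have := hα.pow_inj l.2 l'.2 (mul_left_cancel₀ (pow_ne_zero _ hβ0) h)
    rw [Fin.ext this]
  · have := congrArg (· ^ N) h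
    simp only [cosetNodes_pow_inl hαN hβN, cosetNodes_pow_inr hαN hβN] at this
    exact absurd this.symm hγN
  · have := congrArg (· ^ N) h
    simp only [cosetNodes_pow_inl hαN hβN, cosetNodes_pow_inr hαN hβN] at this
    exact absurd this hγN
  · simp only [cosetNodes, Sum.elim_inr] at h
    have := congrArg (· ^ m') h
    simp only [mul_pow, pow_right_comm _ _ m', hβ.pow_eq_one, one_pow, mul_one] at this
    obtain rfl := hν (mul_left_cancel₀ (pow_ne_zero _ hγ0) this)
    have := hβ.pow_inj l.2 l'.2
      (mul_left_cancel₀ (mul_ne_zero hγ0 (pow_ne_zero _ hα0)) h)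
    rw [Fin.ext this]

open Polynomial in
lemma nodal_cosetNodes (hα : IsPrimitiveRoot α m) (hβ : IsPrimitiveRoot β m')
    (hm : 0 < m) (hm' : 0 < m') :
    Lagrange.nodal univ (cosetNodes α β γ s m t m') =
      (∏ i : Fin s, (X ^ m - C ((β ^ m) ^ (i : ℕ)))) *
        ∏ j : Fin t, (X ^ m' - C (γ ^ m' * (α ^ m') ^ (j : ℕ))) := by
  rw [Lagrange.nodal, Fintype.prod_sum_type, Fintype.prod_prod_type, Fintype.prod_prod_type]
  simp only [cosetNodes, Sum.elim_inl, Sum.elim_inr, prod_X_sub_C_coset hα hm,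
    prod_X_sub_C_coset hβ hm', mul_pow, pow_right_comm _ _ m, pow_right_comm _ _ m']

lemma prod_erase_inl_cosetNodes (hα : IsPrimitiveRoot α m) (hβ : IsPrimitiveRoot β m')
    (hm : 0 < m) (hm' : 0 < m') (p : Fin s × Fin m) :
    ∏ j ∈ univ.erase (.inl p),
        (cosetNodes α β γ s m t m' (.inl p) - cosetNodes α β γ s m t m' j) =
      m * cosetNodes α β γ s m t m' (.inl p) ^ (m - 1) *
        ((∏ i ∈ univ.erase p.1, ((β ^ m) ^ (p.1 : ℕ) - (β ^ m) ^ (i : ℕ))) *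
          ∏ j : Fin t, ((β ^ m') ^ (p.1 : ℕ) * (α ^ m') ^ (p.2 : ℕ) -
            γ ^ m' * (α ^ m') ^ (j : ℕ))) := by
  have hx : cosetNodes α β γ s m t m' (.inl p) ^ m = (β ^ m) ^ (p.1 : ℕ) := by
    simp [cosetNodes, mul_pow, pow_right_comm _ _ m, hα.pow_eq_one]
  have hx' : cosetNodes α β γ s m t m' (.inl p) ^ m' =
      (β ^ m') ^ (p.1 : ℕ) * (α ^ m') ^ (p.2 : ℕ) := by
    simp [cosetNodes, mul_pow, pow_right_comm _ _ m']
  rw [← Lagrange.eval_nodal, ← Lagrange.eval_nodal_derivative_eval_node_eq (mem_univ _),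
    nodal_cosetNodes hα hβ hm hm', eval_derivative_prod_mul (mem_univ p.1) (by simp [hx])]
  simp only [Polynomial.derivative_sub, Polynomial.derivative_C, Polynomial.derivative_X_pow]
  simp [hx, hx', Polynomial.eval_prod]

lemma prod_erase_inr_cosetNodes (hα : IsPrimitiveRoot α m) (hβ : IsPrimitiveRoot β m')
    (hm : 0 < m) (hm' : 0 < m') (p : Fin t × Fin m') :
    ∏ j ∈ univ.erase (.inr p),
        (cosetNodes α β γ s m t m' (.inr p) - cosetNodes α β γ s m t m' j) =
      m' * cosetNodes α β γ s m t m' (.inr p) ^ (m' - 1) *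
        ((∏ j ∈ univ.erase p.1, (γ ^ m' * ((α ^ m') ^ (p.1 : ℕ) - (α ^ m') ^ (j : ℕ)))) *
          ∏ i : Fin s, (γ ^ m * (β ^ m) ^ (p.2 : ℕ) - (β ^ m) ^ (i : ℕ))) := by
  have hx : cosetNodes α β γ s m t m' (.inr p) ^ m = γ ^ m * (β ^ m) ^ (p.2 : ℕ) := by
    simp [cosetNodes, mul_pow, pow_right_comm _ _ m, hα.pow_eq_one]
  have hx' : cosetNodes α β γ s m t m' (.inr p) ^ m' = γ ^ m' * (α ^ m') ^ (p.1 : ℕ) := by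
    simp [cosetNodes, mul_pow, pow_right_comm _ _ m', hβ.pow_eq_one]
  rw [← Lagrange.eval_nodal, ← Lagrange.eval_nodal_derivative_eval_node_eq (mem_univ _),
    nodal_cosetNodes hα hβ hm hm', mul_comm,
    eval_derivative_prod_mul (mem_univ p.1) (by simp [hx'])]
  simp only [Polynomial.derivative_sub, Polynomial.derivative_C, Polynomial.derivative_X_pow]
  simp [hx, hx', Polynomial.eval_prod, mul_sub]

end cosetNodes

/-- The quadratic character is constant on the values `δ(x)` over each of the two families. -/
lemma exists_const_pow_prod_erase_cosetNodes {α β γ : F} {s m t m' r h : ℕ}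
    (hr : r + 1 = 2 * h) (hh : 2 ≤ h)
    (hfrob : ∀ x y : F, (x - y) ^ r = x ^ r - y ^ r) (hcast : ∀ n : ℕ, (n : F) ^ r = n)
    (hα : IsPrimitiveRoot α m) (hβ : IsPrimitiveRoot β m') (hm : 0 < m) (hm' : 0 < m')
    (hαN : α ^ ((r - 1) * h) = 1) (hβN : β ^ ((r - 1) * h) = 1)
    (hω : (β ^ m) ^ h = 1) (hν : (α ^ m') ^ r = α ^ m') (hμ : (γ ^ m') ^ r = γ ^ m')
    (hγ : (γ ^ m) ^ (r + 1) = 1)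
    (hinj : Function.Injective (cosetNodes α β γ s m t m')) :
    ∃ K₁ K₂ : F,
      (∀ p, (∏ j ∈ univ.erase (.inl p), (cosetNodes α β γ s m t m' (.inl p) -
        cosetNodes α β γ s m t m' j)) ^ ((r - 1) * h) = K₁) ∧
      (∀ p, (∏ j ∈ univ.erase (.inr p), (cosetNodes α β γ s m t m' (.inr p) -
        cosetNodes α β γ s m t m' j)) ^ ((r - 1) * h) = K₂) := by
  have hfix : ∀ z : F, z ≠ 0 → z ^ r = z → z ^ ((r - 1) * h) = 1 := fun z hz hzr => by
    have : z ^ (r - 1) = 1 := mul_right_cancel₀ hz <| by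
      rw [← pow_succ, Nat.sub_add_cancel (by omega), hzr, one_mul]
    rw [pow_mul, this, one_pow]
  have hδ : ∀ i, ∏ j ∈ univ.erase i,
      (cosetNodes α β γ s m t m' i - cosetNodes α β γ s m t m' j) ≠ 0 := fun i =>
    prod_ne_zero_iff.2 fun j hj => sub_ne_zero.2 fun h => (mem_erase.1 hj).1 (hinj h).symm
  have hωpow : ∀ i : ℕ, ((β ^ m) ^ i) ^ h = 1 := fun i => by
    rw [pow_right_comm, hω, one_pow]
  have hνpow : ∀ i : ℕ, ((α ^ m') ^ i) ^ r = (α ^ m') ^ i := fun i => by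
    rw [pow_right_comm, hν]
  have hnorm : ∀ y w : F, y - w ≠ 0 → y ^ (r + 1) = 1 → w ^ h = 1 →
      (y - w) ^ ((r - 1) * h) = (-1) ^ h / y ^ h := fun y w hyw hy hw => by
    have hy0 : y ≠ 0 := by rintro rfl; simp at hy
    rw [eq_div_iff (pow_ne_zero _ hy0), mul_comm,
      mul_pow_sub_of_norm_eq_one hr hh hfrob hyw hy hw]
  refine ⟨((-1) ^ h) ^ (s - 1),
    (γ ^ ((r - 1) * h)) ^ (m' - 1) *
      (((γ ^ m') ^ ((r - 1) * h)) ^ (t - 1) * ((-1) ^ h / (γ ^ m) ^ h) ^ s),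
    fun p => ?_, fun p => ?_⟩
  · have h0 := hδ (.inl p)
    have hβm' : (β ^ m') = 1 := hβ.pow_eq_one
    rw [prod_erase_inl_cosetNodes hα hβ hm hm'] at h0 ⊢
    simp only [mul_ne_zero_iff, prod_ne_zero_iff] at h0
    obtain ⟨⟨hm0, -⟩, h1, h2⟩ := h0
    rw [mul_pow, mul_pow, mul_pow, ← prod_pow, ← prod_pow, hfix _ hm0 (hcast m),
      pow_right_comm, cosetNodes_pow_inl hαN hβN, one_pow, one_mul, one_mul,
      prod_congr rfl fun i hi => hnorm _ _ (h1 i hi) (by rw [hr, mul_comm 2, pow_mul, hωpow,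
        one_pow]) (hωpow i),
      prod_eq_one fun j hj => hfix _ (h2 j hj) ?_]
    · simp [hωpow]
    · rw [hβm', one_pow, one_mul, hfrob, mul_pow, hνpow, hνpow, hμ]
  · have h0 := hδ (.inr p)
    rw [prod_erase_inr_cosetNodes hα hβ hm hm'] at h0 ⊢
    simp only [mul_ne_zero_iff, prod_ne_zero_iff] at h0
    obtain ⟨⟨hm0, -⟩, h1, h2⟩ := h0
    rw [mul_pow, mul_pow, mul_pow, ← prod_pow, ← prod_pow, hfix _ hm0 (hcast m'),
      pow_right_comm, cosetNodes_pow_inr hαN hβN, one_mul,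
      prod_congr rfl fun j hj => (mul_pow _ _ _).trans (congrArg _ (hfix _ (h1 j hj).2
        (by rw [hfrob, hνpow, hνpow]))),
      prod_congr rfl fun i hi => hnorm _ _ (h2 i hi) (by
        rw [mul_pow, hγ, hr, mul_comm 2, pow_mul, hωpow, one_pow, one_mul]) (hωpow i)]
    simp [mul_pow, hωpow, div_pow]

lemma frobenius_of_card_eq_sq [Fintype F] {r : ℕ} (hcard : Fintype.card F = r ^ 2)
    (hr : IsPrimePow r) :
    (∀ x y : F, (x - y) ^ r = x ^ r - y ^ r) ∧ ∀ n : ℕ, (n : F) ^ r = n := by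
  obtain ⟨p, hp⟩ := CharP.exists F
  obtain ⟨n, hpp, hn⟩ := FiniteField.card F p
  have : Fact p.Prime := ⟨hpp⟩
  have : r ∣ p ^ (n : ℕ) := by rw [← hn, hcard]; exact dvd_pow_self _ two_ne_zero
  obtain ⟨k, -, rfl⟩ := (Nat.dvd_prime_pow hpp).1 this
  exact ⟨fun x y => sub_pow_char_pow .., fun n => map_natCast (iterateFrobenius F p k) n⟩

/-- An odd `e` for which `θ ^ e` can serve as the shift of the second family of cosets. -/
lemma exists_odd_shift {r a b : ℕ} (hae : Even a) (hbe : Even b)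
    (hab : 2 * a ∣ b * (r + 1)) (hba : 2 * b ∣ a * (r - 1))
    (hcase : (r % 4 = 1 ∧ a % 4 = 2) ∨ (r % 4 = 3 ∧ b % 4 = 2)) :
    ∃ e, Odd e ∧ a ∣ e * (r + 1) ∧ b ∣ e * (r - 1) := by
  obtain ⟨a', rfl⟩ := hae.two_dvd
  obtain ⟨b', rfl⟩ := hbe.two_dvd
  have hr1 : 2 ∣ r + 1 := by omega
  have hr2 : 2 ∣ r - 1 := by omega
  rcases hcase with ⟨-, h⟩ | ⟨-, h⟩
  · refine ⟨a', Nat.odd_iff.2 (by omega), ?_, ?_⟩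
    · rw [mul_comm]; exact mul_dvd_mul_left _ hr1
    · rw [mul_assoc 2 a'] at hba
      exact Nat.dvd_of_mul_dvd_mul_left two_pos hba
  · refine ⟨b', Nat.odd_iff.2 (by omega), ?_, ?_⟩
    · rw [mul_assoc 2 b'] at hab
      exact Nat.dvd_of_mul_dvd_mul_left two_pos hab
    · rw [mul_comm]; exact mul_dvd_mul_left _ hr2

/-- If the quadratic characters of `f i` and `x i`
depend only on the part of the index type, with `x` square on the first part and nonsquare on
the second, then `f` becomes a square after multiplication by some `c * x ^ ε`. -/
lemma exists_isSquare_mul_pow [Fintype F] (hF : ringChar F ≠ 2) {ι ι' : Type*}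
    {f x : ι ⊕ ι' → F} (hf : ∀ i, f i ≠ 0) (hx : ∀ i, x i ≠ 0) {K₁ K₂ γ : F}
    (hγ : ¬ IsSquare γ)
    (hx₁ : ∀ i, x (.inl i) ^ (Fintype.card F / 2) = 1)
    (hx₂ : ∀ i, x (.inr i) ^ (Fintype.card F / 2) = γ ^ (Fintype.card F / 2))
    (hf₁ : ∀ i, f (.inl i) ^ (Fintype.card F / 2) = K₁)
    (hf₂ : ∀ i, f (.inr i) ^ (Fintype.card F / 2) = K₂)
    (i₁ : ι) (i₂ : ι') :
    ∃ c : F, c ≠ 0 ∧ ∃ ε ≤ 1, ∀ i, IsSquare (c * x i ^ ε * f i) := by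
  have hγ0 : γ ≠ 0 := by rintro rfl; simp at hγ
  have hγN : γ ^ (Fintype.card F / 2) = -1 :=
    (FiniteField.pow_dichotomy hF hγ0).resolve_left fun h =>
      hγ ((FiniteField.isSquare_iff hF hγ0).2 h)
  have hsq : ∀ c ≠ 0, ∀ ε : ℕ, c ^ (Fintype.card F / 2) * K₁ = 1 →
      c ^ (Fintype.card F / 2) * (-1) ^ ε * K₂ = 1 → ∀ i, IsSquare (c * x i ^ ε * f i) := by
    intro c hc ε h1 h2 i
    rw [FiniteField.isSquare_iff hF (mul_ne_zero (mul_ne_zero hc (pow_ne_zero _ (hx i))) (hf i)),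
      mul_pow, mul_pow, pow_right_comm]
    rcases i with i | i
    · rw [hx₁, hf₁, one_pow, mul_one, h1]
    · rw [hx₂, hf₂, hγN, h2]
  have hK₁ := hf₁ i₁ ▸ FiniteField.pow_dichotomy hF (hf (.inl i₁))
  have hK₂ := hf₂ i₂ ▸ FiniteField.pow_dichotomy hF (hf (.inr i₂))
  rcases hK₁ with h1 | h1 <;> rcases hK₂ with h2 | h2
  · exact ⟨1, one_ne_zero, 0, by simp, hsq _ one_ne_zero _ (by simp [h1]) (by simp [h2])⟩
  · exact ⟨1, one_ne_zero, 1, le_rfl, hsq _ one_ne_zero _ (by simp [h1]) (by simp [h2])⟩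
  · exact ⟨γ, hγ0, 1, le_rfl, hsq _ hγ0 _ (by simp [h1, hγN]) (by simp [h2, hγN])⟩
  · exact ⟨γ, hγ0, 0, by simp, hsq _ hγ0 _ (by simp [h1, hγN]) (by simp [h2, hγN])⟩

/-- Powers `(θ ^ (b m)) ^ i` of a primitive root of unity of order `a m` are distinct for `i`
below `a / gcd a b`. -/
lemma injective_pow_of_le_div_gcd {θ : F} {a b m s : ℕ} (hθ : IsPrimitiveRoot θ (a * m))
    (hb : 0 < b) (hm : 0 < m) (hs : s ≤ a / Nat.gcd a b) :
    Function.Injective fun i : Fin s => ((θ ^ b) ^ m) ^ (i : ℕ) := by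
  have hord : orderOf ((θ ^ b) ^ m) = a / Nat.gcd a b := by
    rw [← pow_mul, orderOf_pow' _ (mul_pos hb hm).ne', ← hθ.eq_orderOf, Nat.gcd_mul_right,
      Nat.mul_div_mul_right _ _ hm]
  have := hord ▸ IsPrimitiveRoot.orderOf ((θ ^ b) ^ m)
  exact fun i j hij => Fin.ext (this.pow_inj (i.2.trans_le hs) (j.2.trans_le hs) hij)

/-- Theorem 3: `q = r²`, `a, b` even divisors of `q-1` with `2a ∣ b(r+1)`, `2b ∣ a(r-1)`,
and either (`r ≡ 1 (mod 4)` and `a ≡ 2 (mod 4)`) or (`r ≡ 3 (mod 4)` and `b ≡ 2 (mod 4)`).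
For `n = s(q-1)/a + t(q-1)/b` with `1 ≤ s ≤ a/gcd(a,b)`, `1 ≤ t ≤ b/gcd(a,b)`, and every
`1 ≤ k ≤ n/2 - 1`, there exists a `q`-ary `[n, k]` MDS Euclidean self-orthogonal code. -/
theorem stmt16 {F : Type*} [Field F] [Fintype F] {q r : ℕ} (hq : Fintype.card F = q)
    (hq2 : q = r ^ 2) (hpp : IsPrimePow r)
    {a b : ℕ} (hae : Even a) (hbe : Even b) (ha : a ∣ q - 1) (hb : b ∣ q - 1)
    (hab : 2 * a ∣ b * (r + 1)) (hba : 2 * b ∣ a * (r - 1))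
    (hcase : (r % 4 = 1 ∧ a % 4 = 2) ∨ (r % 4 = 3 ∧ b % 4 = 2))
    {s t : ℕ} (hs1 : 1 ≤ s) (hs2 : s ≤ a / Nat.gcd a b)
    (ht1 : 1 ≤ t) (ht2 : t ≤ b / Nat.gcd a b) :
    ∀ k : ℕ, 1 ≤ k → k ≤ (s * ((q - 1) / a) + t * ((q - 1) / b)) / 2 - 1 →
      ∃ C : Submodule F (Fin (s * ((q - 1) / a) + t * ((q - 1) / b)) → F),
        IsMDSCode C k ∧ C ≤ dualCode C := by
  classical
  intro k hk1 hk
  obtain ⟨e, he, hea, heb⟩ := exists_odd_shift hae hbe hab hba hcase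
  obtain ⟨h, hr⟩ : ∃ h, r + 1 = 2 * h := ⟨(r + 1) / 2, by omega⟩
  have hcard : Fintype.card F = r ^ 2 := hq.trans hq2
  have hr1 : r ≠ 1 := hpp.ne_one
  have hh : 2 ≤ h := by omega
  have hM : q - 1 = 2 * ((r - 1) * h) := by
    rw [hq2, show r ^ 2 - 1 = (r + 1) * (r - 1) from Nat.sq_sub_sq r 1, hr]; ring
  have hMpos : 0 < (r - 1) * h := Nat.mul_pos (by omega) (by omega)
  have hN : Fintype.card F / 2 = (r - 1) * h := by omega
  have hF : ringChar F ≠ 2 := fun hF => by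
    have := FiniteField.even_card_iff_char_two.1 hF
    omega
  obtain ⟨hfrob, hcast⟩ := frobenius_of_card_eq_sq hcard hpp
  obtain ⟨θ, hθ⟩ : ∃ θ : F, IsPrimitiveRoot θ (q - 1) := by
    obtain ⟨g, hg⟩ := IsCyclic.exists_ofOrder_eq_natCard (α := Fˣ)
    refine ⟨g, IsPrimitiveRoot.coe_units_iff.2 ?_⟩
    rw [← hq, ← Fintype.card_units, ← Nat.card_eq_fintype_card, ← hg]
    exact IsPrimitiveRoot.orderOf g
  have hθ0 : θ ≠ 0 := hθ.ne_zero (by omega)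
  obtain ⟨m, hm⟩ := ha
  obtain ⟨m', hm'⟩ := hb
  have hθdvd : ∀ {j : ℕ}, q - 1 ∣ j → θ ^ j = 1 := fun hj => (hθ.pow_eq_one_iff_dvd _).2 hj
  have hpos : 0 < a * m ∧ 0 < b * m' := by omega
  have ha0 := Nat.pos_of_mul_pos_right hpos.1
  have hm0 := Nat.pos_of_mul_pos_left hpos.1
  have hb0 := Nat.pos_of_mul_pos_right hpos.2
  have hm0' := Nat.pos_of_mul_pos_left hpos.2
  rw [hm, Nat.mul_div_cancel_left _ ha0, ← hm, hm', Nat.mul_div_cancel_left _ hb0] at hk ⊢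
  have hθN : θ ^ ((r - 1) * h) ≠ 1 := hθ.pow_ne_one_of_pos_of_lt (by omega) (by omega)
  have heven : ∀ {j : ℕ}, Even j → (θ ^ j) ^ ((r - 1) * h) = 1 := by
    rintro _ ⟨j, rfl⟩
    rw [← pow_mul]
    exact hθdvd ⟨j, by rw [hM]; ring⟩
  have hγN : (θ ^ e) ^ ((r - 1) * h) ≠ 1 := by
    obtain ⟨j, rfl⟩ := he
    rwa [pow_succ, mul_pow, heven (even_two_mul j), one_mul]
  have hfix : ∀ {j : ℕ}, q - 1 ∣ j * (r - 1) → (θ ^ j) ^ r = θ ^ j := fun {j} hj => by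
    rw [← pow_mul, show j * r = j * (r - 1) + j by
      rw [← Nat.mul_succ]; congr; omega, pow_add, hθdvd hj, one_mul]
  have hα : IsPrimitiveRoot (θ ^ a) m := hθ.pow (by omega) hm
  have hβ : IsPrimitiveRoot (θ ^ b) m' := hθ.pow (by omega) hm'
  have hinj : Function.Injective (cosetNodes (θ ^ a) (θ ^ b) (θ ^ e) s m t m') :=
    cosetNodes_injective hα hβ (pow_ne_zero _ hθ0) (pow_ne_zero _ hθ0) (pow_ne_zero _ hθ0)
      (heven hae) (heven hbe) hγN
      (injective_pow_of_le_div_gcd (hm ▸ hθ) hb0 hm0 hs2)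
      (injective_pow_of_le_div_gcd (hm' ▸ hθ) ha0 hm0' (Nat.gcd_comm a b ▸ ht2))
  have hω : ((θ ^ b) ^ m) ^ h = 1 := by
    obtain ⟨c, hc⟩ := hab
    rw [← pow_mul, ← pow_mul]
    refine hθdvd ⟨c, ?_⟩
    rw [hr] at hc
    rw [hm]
    have : b * h = a * c := by linarith
    linear_combination m * this
  have hν : ((θ ^ a) ^ m') ^ r = (θ ^ a) ^ m' := by
    rw [← pow_mul θ]
    refine hfix ?_
    obtain ⟨c, hc⟩ := hba
    exact ⟨2 * c, by rw [hm']; linear_combination m' * hc⟩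
  have hμ : ((θ ^ e) ^ m') ^ r = (θ ^ e) ^ m' := by
    rw [← pow_mul θ]
    refine hfix ?_
    obtain ⟨c, hc⟩ := heb
    exact ⟨c, by rw [hm']; linear_combination m' * hc⟩
  have hγ : ((θ ^ e) ^ m) ^ (r + 1) = 1 := by
    rw [← pow_mul, ← pow_mul]
    obtain ⟨c, hc⟩ := hea
    exact hθdvd ⟨c, by rw [hm]; linear_combination m * hc⟩
  obtain ⟨K₁, K₂, hK₁, hK₂⟩ := exists_const_pow_prod_erase_cosetNodes hr hh hfrob hcast hα hβ
    hm0 hm0' (heven hae) (heven hbe) hω hν hμ hγ hinj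
  have hx0 : ∀ i, cosetNodes (θ ^ a) (θ ^ b) (θ ^ e) s m t m' i ≠ 0 := by
    rintro (p | p) <;> simp [cosetNodes, hθ0]
  obtain ⟨c, hc, ε, hε, hsq⟩ := exists_isSquare_mul_pow hF
    (f := fun i => ∏ j ∈ univ.erase i, (cosetNodes (θ ^ a) (θ ^ b) (θ ^ e) s m t m' i -
      cosetNodes (θ ^ a) (θ ^ b) (θ ^ e) s m t m' j))
    (fun i => prod_ne_zero_iff.2 fun j hj =>
      sub_ne_zero.2 fun h => (mem_erase.1 hj).1 (hinj h).symm) hx0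
    (mt (FiniteField.isSquare_iff hF (pow_ne_zero e hθ0)).1 (hN ▸ hγN))
    (hN ▸ cosetNodes_pow_inl (heven hae) (heven hbe))
    (hN ▸ cosetNodes_pow_inr (heven hae) (heven hbe))
    (hN ▸ hK₁) (hN ▸ hK₂) (⟨0, hs1⟩, ⟨0, hm0⟩) (⟨0, ht1⟩, ⟨0, hm0'⟩)
  exact exists_isMDSCode_le_dualCode hinj hx0 hc (by simp) hk1 (by omega) hsq
end
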